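/- Let N ≥ 0 and p ∈ ℝ, and let 𝒦_{N+1}(p,N) be the (N+1)×(N+1) real tridiagonal matrix (indexed 0,…,N) with diagonal entries (𝒦)_{n,n} = pN + n(1−2p), superdiagonal entries (𝒦)_{n,n+1} = p(N−n), and subdiagonal entries (𝒦)_{n,n−1} = n(1−p). Then for every real x, det(𝒦_{N+1}(p,N) − x·I_{N+1}) = ∏_{j=0}^{N} (j − x); that is, the determinant equals the shifted factorial (−x)_{N+1} = (−x)(−x+1)⋯(−x+N). -/

import Mathlib

/-- The Krawtchouk matrix `𝒦_{N+1}(p, N)`: diagonal entries `pN + n(1 - 2p)`,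
superdiagonal entries `p(N - n)`, subdiagonal entries `n(1 - p)` (0-indexed, size `N + 1`). -/
def krawtchoukK (N : ℕ) (p : ℝ) : Matrix (Fin (N + 1)) (Fin (N + 1)) ℝ :=
  Matrix.of fun i j =>
    if (j : ℕ) = (i : ℕ) + 1 then p * ((N : ℝ) - (i : ℕ))
    else if (i : ℕ) = (j : ℕ) + 1 then ((i : ℕ) : ℝ) * (1 - p)
    else if i = j then p * (N : ℝ) + ((i : ℕ) : ℝ) * (1 - 2 * p)
    else 0
/-- The alternating Pascal matrix `(-1)^i * (i choose j)`. -/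
def alternatingPascal (N : ℕ) : Matrix (Fin (N + 1)) (Fin (N + 1)) ℝ :=
  Matrix.of fun i j => (-1) ^ (i : ℕ) * ((i : ℕ).choose j : ℝ)

/-- The upper bidiagonal matrix with diagonal `0, …, N` to which the Krawtchouk matrix is
conjugate. -/
def krawtchoukBidiagonal (N : ℕ) (p : ℝ) : Matrix (Fin (N + 1)) (Fin (N + 1)) ℝ :=
  Matrix.of fun i j =>
    if (i : ℕ) = j then ((j : ℕ) : ℝ)
    else if (i : ℕ) + 1 = j then -p * ((N : ℝ) - (i : ℕ))
    else 0

lemma sum_fin_ite_val_eq (n a : ℕ) (f : ℕ → ℝ) :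
    ∑ k : Fin n, (if (k : ℕ) = a then f k else 0) = if a < n then f a else 0 := by
  rw [Fin.sum_univ_eq_sum_range (fun k => if k = a then f k else 0) n, Finset.sum_ite_eq']
  simp

lemma krawtchoukK_sum_mul (N : ℕ) (p : ℝ) (i : Fin (N + 1)) (f : ℕ → ℝ) :
    ∑ k, krawtchoukK N p i k * f k =
      p * ((N : ℝ) - (i : ℕ)) * f (i + 1) + (p * N + ((i : ℕ) : ℝ) * (1 - 2 * p)) * f i
        + ((i : ℕ) : ℝ) * (1 - p) * f (i - 1) := by
  have h : ∀ k : Fin (N + 1), krawtchoukK N p i k * f k =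
      (if (k : ℕ) = i + 1 then p * ((N : ℝ) - (i : ℕ)) * f k else 0)
      + (if (k : ℕ) = i then (p * N + ((i : ℕ) : ℝ) * (1 - 2 * p)) * f k else 0)
      + (if (k : ℕ) = i - 1 then ((i : ℕ) : ℝ) * (1 - p) * f k else 0) := by
    intro k
    simp only [krawtchoukK, Matrix.of_apply, Fin.ext_iff]
    rcases Nat.eq_zero_or_pos (i : ℕ) with h0 | h0
    · simp only [h0]
      split_ifs <;> first | contradiction | omega | simp
    · split_ifs <;> first | omega | simp
  simp only [h, Finset.sum_add_distrib]
  rw [sum_fin_ite_val_eq _ _ (fun k => p * ((N : ℝ) - (i : ℕ)) * f k),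
    sum_fin_ite_val_eq _ _ (fun k => (p * N + ((i : ℕ) : ℝ) * (1 - 2 * p)) * f k),
    sum_fin_ite_val_eq _ _ (fun k => ((i : ℕ) : ℝ) * (1 - p) * f k),
    if_pos i.isLt, if_pos (by omega : (i : ℕ) - 1 < N + 1)]
  split_ifs with hi
  · rfl
  · have : (i : ℕ) = N := by omega
    simp [this]

lemma sum_mul_krawtchoukBidiagonal (N : ℕ) (p : ℝ) (j : Fin (N + 1)) (f : ℕ → ℝ) :
    ∑ k : Fin (N + 1), f k * krawtchoukBidiagonal N p k j =
      f j * (j : ℕ) + if (j : ℕ) = 0 then 0 else f (j - 1) * (-p * ((N : ℝ) - (j - 1 : ℕ))) := by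
  have h : ∀ k : Fin (N + 1), f k * krawtchoukBidiagonal N p k j =
      (if (k : ℕ) = j then f k * (j : ℕ) else 0)
      + (if (k : ℕ) = j - 1 then
          (if (j : ℕ) = 0 then 0 else f k * (-p * ((N : ℝ) - (k : ℕ)))) else 0) := by
    intro k
    simp only [krawtchoukBidiagonal, Matrix.of_apply]
    split_ifs <;> first | omega | simp
  simp only [h, Finset.sum_add_distrib]
  rw [sum_fin_ite_val_eq _ _ (fun k => f k * (j : ℕ)),
    sum_fin_ite_val_eq _ _
      (fun k => if (j : ℕ) = 0 then 0 else f k * (-p * ((N : ℝ) - (k : ℕ)))),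
    if_pos j.isLt, if_pos (by omega : (j : ℕ) - 1 < N + 1)]

lemma krawtchoukK_mul_alternatingPascal (N : ℕ) (p : ℝ) :
    krawtchoukK N p * alternatingPascal N =
      alternatingPascal N * krawtchoukBidiagonal N p := by
  ext i j
  rw [Matrix.mul_apply, Matrix.mul_apply]
  simp only [alternatingPascal, Matrix.of_apply]
  rw [krawtchoukK_sum_mul N p i (fun k => (-1) ^ k * (k.choose j : ℝ)),
    sum_mul_krawtchoukBidiagonal N p j (fun k => (-1) ^ (i : ℕ) * ((i : ℕ).choose k : ℝ))]
  generalize (i : ℕ) = n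
  generalize (j : ℕ) = m
  rcases n with _ | n <;> rcases m with _ | m
  · simp
  · rcases m with _ | m <;> simp [Nat.choose_succ_succ]
  · simp [pow_succ]
    ring
  · have h₁ : ((n : ℝ) + 1) * n.choose m = (n + 1).choose (m + 1) * (m + 1) := by
      exact_mod_cast Nat.add_one_mul_choose_eq n m
    have h₂ : ((n + 1).choose (m + 1) : ℝ) = n.choose m + n.choose (m + 1) := by
      exact_mod_cast Nat.choose_succ_succ n m
    have h₃ : ((n + 2).choose (m + 1) : ℝ) = (n + 1).choose m + (n + 1).choose (m + 1) := by
      exact_mod_cast Nat.choose_succ_succ (n + 1) m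
    have h₄ : ((n : ℝ) + 1 - m) * (n + 1).choose m = (n + 1).choose (m + 1) * (m + 1) := by
      rcases le_or_gt m (n + 1) with h | h
      · have := Nat.choose_succ_right_eq (n + 1) m
        zify [h] at this
        have h' : (((n + 1).choose (m + 1) : ℝ)) * (m + 1) = (n + 1).choose m * (n + 1 - m) := by
          exact_mod_cast this
        linarith
      · simp [Nat.choose_eq_zero_of_lt h, Nat.choose_eq_zero_of_lt (h.trans (Nat.lt_succ_self m))]
    simp only [Nat.add_sub_cancel, Nat.add_eq_zero_iff, one_ne_zero, and_false, if_false,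
      Nat.cast_add, Nat.cast_one, pow_succ, h₃]
    linear_combination (-1 : ℝ) ^ n * (-p * h₄ + p * h₁ - h₁
      + (n + 1) * (1 - p) * (-h₂))

lemma det_alternatingPascal_ne_zero (N : ℕ) : (alternatingPascal N).det ≠ 0 := by
  rw [Matrix.det_of_isLowerTriangular]
  · simp [alternatingPascal, Finset.prod_ne_zero_iff]
  · intro i j h
    have h' : (i : ℕ) < j := h
    simp [alternatingPascal, Nat.choose_eq_zero_of_lt h']

lemma det_krawtchoukBidiagonal_sub (N : ℕ) (p x : ℝ) :
    (krawtchoukBidiagonal N p - x • (1 : Matrix (Fin (N + 1)) (Fin (N + 1)) ℝ)).det =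
      ∏ j ∈ Finset.range (N + 1), ((j : ℝ) - x) := by
  rw [Matrix.det_of_isUpperTriangular]
  · rw [← Fin.prod_univ_eq_prod_range (fun j => (j : ℝ) - x)]
    simp [krawtchoukBidiagonal]
  · intro i j h
    have h' : (j : ℕ) < i := h
    have hne : i ≠ j := by
      rintro rfl
      exact lt_irrefl _ h'
    simp [krawtchoukBidiagonal, Matrix.one_apply_ne hne, h'.ne',
      show (i : ℕ) + 1 ≠ j by omega]

theorem krawtchouk_det (N : ℕ) (p : ℝ) (x : ℝ) :
    (krawtchoukK N p - x • (1 : Matrix (Fin (N + 1)) (Fin (N + 1)) ℝ)).det =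
      ∏ j ∈ Finset.range (N + 1), ((j : ℝ) - x) := by
  apply mul_right_cancel₀ (det_alternatingPascal_ne_zero N)
  rw [← det_krawtchoukBidiagonal_sub N p x, ← Matrix.det_mul, mul_comm, ← Matrix.det_mul,
    sub_mul, mul_sub, krawtchoukK_mul_alternatingPascal]
  simp
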